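/- arXiv:1405.5368 — 8 statements merged into one kernel-verified Lean document; each statement's English description precedes it below -/
import Mathlib

section
/- Let U(2) denote the unitary group of 2×2 complex matrices, regarded as a topological group with the subspace topology inherited from the 2×2 complex matrices, let Z be its center, and let q : U(2) → U(2)/Z be the quotient homomorphism onto the quotient topological group. Then q admits no continuous section: there is no continuous map s : U(2)/Z → U(2) such that q ∘ s is the identity on U(2)/Z. -/
namespace NoSection

open Complex

/-- Abbreviation for `U(2)`. -/
abbrev G := Matrix.unitaryGroup (Fin 2) ℂ

/-- A two-parameter family in `SU(2)`, as matrices. -/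
noncomputable def mat (p : ℝ × ℝ) : Matrix (Fin 2) (Fin 2) ℂ :=
  !![cos p.1, -(sin p.1 * exp (-(p.2 * I))); sin p.1 * exp (p.2 * I), cos p.1]

theorem conj_exp_mul_I (y : ℝ) : (starRingEnd ℂ) (exp (y * I)) = exp (-(y * I)) := by
  rw [← exp_conj]; simp

theorem conj_exp_neg_mul_I (y : ℝ) : (starRingEnd ℂ) (exp (-(y * I))) = exp (y * I) := by
  rw [← exp_conj]; simp

theorem mat_mem (p : ℝ × ℝ) : mat p ∈ Matrix.unitaryGroup (Fin 2) ℂ := by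
  rw [Matrix.mem_unitaryGroup_iff]
  have h1 : exp (p.2 * I) * exp (-(p.2 * I)) = 1 := by rw [← exp_add]; simp
  have h2 := cos_sq_add_sin_sq (p.1 : ℂ)
  have hc : (starRingEnd ℂ) (cos p.1) = cos p.1 := by rw [← cos_conj]; simp
  have hs : (starRingEnd ℂ) (sin p.1) = sin p.1 := by rw [← sin_conj]; simp
  ext i j
  fin_cases i <;> fin_cases j <;>
    simp [mat, Matrix.mul_apply, Fin.sum_univ_two, Matrix.star_apply, conj_exp_mul_I,
      conj_exp_neg_mul_I, hc, hs]
  · linear_combination h2 + (sin p.1)^2 * h1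
  · ring
  · ring
  · linear_combination h2 + (sin p.1)^2 * h1

/-- The same family, in `U(2)`. -/
noncomputable def U (p : ℝ × ℝ) : G := ⟨mat p, mat_mem p⟩

theorem continuous_U : Continuous U := by
  refine Continuous.subtype_mk ?_ _
  refine continuous_matrix fun i j => ?_
  fin_cases i <;> fin_cases j <;> simp [mat] <;> fun_prop

theorem U_shift (x y : ℝ) : U (x + Real.pi, y) = -U (x, y) := by
  apply Subtype.ext
  change mat (x + Real.pi, y) = -mat (x, y)
  ext i j
  fin_cases i <;> fin_cases j <;> simp [mat, cos_add_pi, sin_add_pi]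

theorem U_flip (x y : ℝ) : U (-x, y + Real.pi) = U (x, y) := by
  have e1 : exp (((y : ℂ) + Real.pi) * I) = - exp (y * I) := by
    rw [add_mul, exp_add, exp_pi_mul_I]; ring
  have e2 : exp (-(((y : ℂ) + Real.pi) * I)) = - exp (-(y * I)) := by
    rw [exp_neg, e1, exp_neg, inv_neg]
  apply Subtype.ext
  ext i j
  fin_cases i <;> fin_cases j <;> simp only [U, mat] <;> push_cast <;> simp [e1, e2]

theorem U_zero (y : ℝ) : U (0, y) = U (0, 0) := by
  apply Subtype.ext
  ext i j
  fin_cases i <;> fin_cases j <;> simp [U, mat]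

theorem entry_ne_zero (z : G) (hz : z ∈ Subgroup.center G) : z.1 0 0 ≠ 0 := by
  intro h0
  have hd : (!![1, 0; 0, -1] : Matrix (Fin 2) (Fin 2) ℂ) ∈ Matrix.unitaryGroup (Fin 2) ℂ := by
    rw [Matrix.mem_unitaryGroup_iff]
    ext i j
    fin_cases i <;> fin_cases j <;>
      simp [Matrix.mul_apply, Fin.sum_univ_two, Matrix.star_apply]
  have h := congrArg Subtype.val (Subgroup.mem_center_iff.1 hz ⟨_, hd⟩)
  have h01 := congrFun (congrFun h 0) 1
  have hu := congrFun (congrFun (Matrix.mem_unitaryGroup_iff.1 z.2) 0) 0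
  simp [Matrix.mul_apply, Fin.sum_univ_two] at h01
  have h01' : z.1 0 1 = 0 := by linear_combination h01 / 2
  simp [Matrix.mul_apply, Fin.sum_univ_two, Matrix.star_apply, h0, h01'] at hu

theorem neg_mk (u : G) : ((-u : G) : G ⧸ Subgroup.center G) = u := by
  rw [QuotientGroup.eq, Subgroup.mem_center_iff]
  intro g
  simp

theorem lift_const {X : Type*} [TopologicalSpace X] [PreconnectedSpace X] {h : X → ℂ}
    (hc : Continuous h) {c : ℂ} (he : ∀ x, exp (h x) = c) (a b : X) : h a = h b :=
  isCoveringMap_exp.const_of_comp hc (fun a b => Subtype.ext ((he a).trans (he b).symm)) a b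

theorem no_lift (f : ℝ × ℝ → ℂ) (hf : Continuous f) (h0 : ∀ p, f p ≠ 0)
    (hs : ∀ x y, f (x + Real.pi, y) = -f (x, y))
    (hfl : ∀ x y, f (-x, y + Real.pi) = f (x, y)) : False := by
  obtain ⟨L, ⟨-, hL⟩, -⟩ := isCoveringMapOn_exp.existsUnique_continuousMap_lifts
    (⟨f, hf⟩ : C(ℝ × ℝ, ℂ)) (a₀ := (0, 0)) (exp_log (h0 (0, 0))) (fun p => h0 p)
  have hL' : ∀ p, exp (L p) = f p := fun p => congrFun hL p
  have A := lift_const (h := fun p : ℝ × ℝ => L (p.1 + Real.pi, p.2) - L p) (c := -1)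
    (by fun_prop) (fun p => by
      rw [exp_sub, hL', hL', hs, neg_div, div_self (h0 _)])
  have B := lift_const (h := fun p : ℝ × ℝ => L (-p.1, p.2 + Real.pi) - L p) (c := 1)
    (by fun_prop) (fun p => by
      rw [exp_sub, hL', hL', hfl, div_self (h0 _)])
  have a1 := A (0, 0) (-Real.pi, Real.pi)
  have b1 := B (0, 0) (Real.pi, 0)
  simp at a1 b1
  have d : L (Real.pi, 0) = L (0, 0) := by linear_combination (a1 + b1) / 2
  have e1 := hL' (Real.pi, 0)
  have e2 := hs 0 0
  rw [zero_add] at e2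
  rw [d, hL', e2] at e1
  exact h0 (0, 0) (by linear_combination e1 / 2)

end NoSection

/-- **Example 2.1 of the paper.**  The quotient homomorphism from `U(2)` onto `U(2)/Z`,
where `Z` is the center of `U(2)`, admits no continuous section. -/
theorem stmt_2 :
    ¬ ∃ s : (Matrix.unitaryGroup (Fin 2) ℂ ⧸ Subgroup.center (Matrix.unitaryGroup (Fin 2) ℂ)) →
        Matrix.unitaryGroup (Fin 2) ℂ,
      Continuous s ∧
        ∀ x, (QuotientGroup.mk' (Subgroup.center (Matrix.unitaryGroup (Fin 2) ℂ))) (s x) = x := by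
  rintro ⟨s, hs, hq⟩
  let F : NoSection.G → NoSection.G := fun u =>
    u⁻¹ * s (u : NoSection.G ⧸ Subgroup.center NoSection.G)
  have hF : Continuous F := continuous_inv.mul (hs.comp QuotientGroup.continuous_mk)
  have hFc : ∀ u, F u ∈ Subgroup.center NoSection.G := fun u =>
    QuotientGroup.eq.1 (hq (u : NoSection.G ⧸ Subgroup.center NoSection.G)).symm
  have hFn : ∀ u, F (-u) = -F u := by
    intro u
    simp only [F]
    rw [NoSection.neg_mk, inv_neg, neg_mul]
  refine NoSection.no_lift (fun p => (F (NoSection.U p)).1 0 0) ?_ ?_ ?_ ?_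
  · exact (continuous_subtype_val.comp (hF.comp NoSection.continuous_U)).matrix_elem 0 0
  · exact fun p => NoSection.entry_ne_zero _ (hFc _)
  · intro x y
    simp only [NoSection.U_shift, hFn]
    rfl
  · intro x y
    simp only [NoSection.U_flip]
end

section
/- With the setup below, an element a ∈ A lies in A_J if and only if there exists λ : I → ℂ such that a i = λ i • 1 (a scalar multiple of the identity matrix) for every i, and λ i = λ j whenever m i j ≠ 0. In particular A_J is contained in the center of A and contains the scalars ℂ·1. -/
open Matrix

noncomputable section

/-- The algebra `A = Π_{i} M_{N i}(ℂ)`. -/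
abbrev Stmt4.AS {I : Type} (N : I → ℕ) : Type :=
  ∀ i : I, Matrix (Fin (N i)) (Fin (N i)) ℂ

/-- The Hilbert space `H = ⊕_{i j} ⊕_{α < m i j} M_{N i, N j}(ℂ)`. -/
abbrev Stmt4.HS {I : Type} (N : I → ℕ) (m : I → I → ℕ) : Type :=
  ∀ i j : I, Fin (m i j) → Matrix (Fin (N i)) (Fin (N j)) ℂ

/-- The action of `A` on `H` by left block multiplication. -/
def Stmt4.act {I : Type} {N : I → ℕ} {m : I → I → ℕ}
    (a : Stmt4.AS N) (h : Stmt4.HS N m) : Stmt4.HS N m :=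
  fun i j α => a i * h i j α

/-- The conjugate-linear map `J` on `H`: `(J h)_{(i,j,α)} = s i j α • (h_{(j,i,α)})ᴴ`. -/
def Stmt4.Jmap {I : Type} {N : I → ℕ} {m : I → I → ℕ} (hm : ∀ i j, m i j = m j i)
    (s : ∀ i j : I, Fin (m i j) → ℂ) (h : Stmt4.HS N m) : Stmt4.HS N m :=
  fun i j α => s i j α • (h j i (Fin.cast (hm i j) α))ᴴ

/-- `A_J = {a ∈ A : a · (J h) = J ((star a) · h) for all h}`. -/
def Stmt4.AJ {I : Type} (N : I → ℕ) (m : I → I → ℕ) (hm : ∀ i j, m i j = m j i)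
    (s : ∀ i j : I, Fin (m i j) → ℂ) : Set (Stmt4.AS N) :=
  {a | ∀ h : Stmt4.HS N m,
    Stmt4.act a (Stmt4.Jmap hm s h) = Stmt4.Jmap hm s (Stmt4.act (fun i => (a i)ᴴ) h)}

theorem Stmt4.key {I : Type} (N : I → ℕ)
    (m : I → I → ℕ) (hm : ∀ i j, m i j = m j i)
    (s : ∀ i j : I, Fin (m i j) → ℂ) (hs : ∀ i j α, s i j α = 1 ∨ s i j α = -1)
    (a : Stmt4.AS N) (ha : a ∈ Stmt4.AJ N m hm s) (i j : I) (hij : m i j ≠ 0)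
    (r x : Fin (N i)) (y : Fin (N j)) : a i r x = if r = x then a j y y else 0 := by
  have h0 := ha (fun p q _ => Matrix.of fun u v =>
    if u.val = y.val ∧ v.val = x.val then 1 else 0)
  have h1 := congrFun (congrFun (congrFun h0 i) j) ⟨0, Nat.pos_of_ne_zero hij⟩
  simp only [Stmt4.act, Stmt4.Jmap, Matrix.mul_smul, Matrix.conjTranspose_mul,
    Matrix.conjTranspose_conjTranspose] at h1
  have hs0 : s i j ⟨0, Nat.pos_of_ne_zero hij⟩ ≠ 0 := by
    rcases hs i j ⟨0, Nat.pos_of_ne_zero hij⟩ with h | h <;> rw [h] <;> norm_num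
  have h2 := congrFun (congrFun (smul_right_injective _ hs0 h1) r) y
  simp only [Matrix.mul_apply, Matrix.conjTranspose_apply, Matrix.of_apply, ← Fin.ext_iff,
    true_and, apply_ite star, star_one, star_zero, mul_ite, mul_one, mul_zero, ite_mul,
    one_mul, zero_mul, Finset.sum_ite_eq', Finset.mem_univ, if_true] at h2
  rw [h2]
  by_cases hrx : r = x <;> simp [hrx]

theorem Stmt4.mem_of {I : Type} (N : I → ℕ)
    (m : I → I → ℕ) (hm : ∀ i j, m i j = m j i)
    (s : ∀ i j : I, Fin (m i j) → ℂ) (a : Stmt4.AS N) (lam : I → ℂ)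
    (h1 : ∀ i, a i = lam i • (1 : Matrix (Fin (N i)) (Fin (N i)) ℂ))
    (h2 : ∀ i j, m i j ≠ 0 → lam i = lam j) : a ∈ Stmt4.AJ N m hm s := by
  intro h
  funext i j α
  have hij : m i j ≠ 0 := fun h => by
    have := α.isLt
    omega
  simp only [Stmt4.act, Stmt4.Jmap, Matrix.mul_smul, Matrix.conjTranspose_mul,
    Matrix.conjTranspose_conjTranspose]
  rw [h1 i, h1 j, h2 i j hij]
  simp

/-- **Proposition 5.1 of the paper.**  `a ∈ A_J` iff each `a i` is a scalar `λ i • 1` and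
`λ i = λ j` whenever `m i j ≠ 0`.  In particular `A_J` is contained in the center of `A`
and contains the scalars `ℂ·1`. -/
theorem stmt_4 {I : Type} [Fintype I] [Nonempty I] (N : I → ℕ) (hN : ∀ i, 0 < N i)
    (m : I → I → ℕ) (hm : ∀ i j, m i j = m j i) (hfaith : ∀ i, ∃ j, m i j ≠ 0)
    (s : ∀ i j : I, Fin (m i j) → ℂ) (hs : ∀ i j α, s i j α = 1 ∨ s i j α = -1) :
    (∀ a : Stmt4.AS N, a ∈ Stmt4.AJ N m hm s ↔
        ∃ lam : I → ℂ, (∀ i, a i = lam i • (1 : Matrix (Fin (N i)) (Fin (N i)) ℂ)) ∧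
          ∀ i j, m i j ≠ 0 → lam i = lam j) ∧
    (∀ a ∈ Stmt4.AJ N m hm s, ∀ b : Stmt4.AS N, (fun i => a i * b i) = (fun i => b i * a i)) ∧
    (∀ c : ℂ, (fun i => c • (1 : Matrix (Fin (N i)) (Fin (N i)) ℂ)) ∈ Stmt4.AJ N m hm s) := by
  have main : ∀ a : Stmt4.AS N, a ∈ Stmt4.AJ N m hm s ↔
        ∃ lam : I → ℂ, (∀ i, a i = lam i • (1 : Matrix (Fin (N i)) (Fin (N i)) ℂ)) ∧
          ∀ i j, m i j ≠ 0 → lam i = lam j := by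
    intro a
    constructor
    · intro ha
      have key := Stmt4.key N m hm s hs a ha
      have hlam : ∀ i j, m i j ≠ 0 → a i ⟨0, hN i⟩ ⟨0, hN i⟩ = a j ⟨0, hN j⟩ ⟨0, hN j⟩ := by
        intro i j hij
        simpa using key i j hij ⟨0, hN i⟩ ⟨0, hN i⟩ ⟨0, hN j⟩
      refine ⟨fun i => a i ⟨0, hN i⟩ ⟨0, hN i⟩, fun i => ?_, hlam⟩
      obtain ⟨j, hij⟩ := hfaith i
      ext r x
      rw [key i j hij r x ⟨0, hN j⟩, ← hlam i j hij]
      simp [Matrix.one_apply]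
    · rintro ⟨lam, h1, h2⟩
      exact Stmt4.mem_of N m hm s a lam h1 h2
  refine ⟨main, fun a ha b => ?_, fun c => ?_⟩
  · obtain ⟨lam, h1, -⟩ := (main a).1 ha
    funext i
    rw [h1 i]
    simp
  · exact (main _).2 ⟨fun _ => c, fun _ => rfl, fun _ _ _ => rfl⟩

end
end

section
/- With the setup below, let ∼ be the equivalence relation on I generated by: i ∼ j whenever m i j ≠ 0. Then A_J is isomorphic as a complex *-algebra to the algebra of complex-valued functions on the quotient I/∼ (with pointwise operations); concretely, a ∈ A_J corresponds to λ̄ : I/∼ → ℂ where a i = λ̄([i]) • 1 for all i. In particular: (1) A_J equals the center of A if and only if m i j = 0 for all i ≠ j; (2) A_J equals the scalars ℂ·1 if and only if i ∼ j for all i, j ∈ I. -/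
open Matrix

noncomputable section

/-- The algebra `A = Π_{i} M_{N i}(ℂ)`. -/
abbrev Stmt5.AS {I : Type} (N : I → ℕ) : Type :=
  ∀ i : I, Matrix (Fin (N i)) (Fin (N i)) ℂ

/-- The Hilbert space `H = ⊕_{i j} ⊕_{α < m i j} M_{N i, N j}(ℂ)`. -/
abbrev Stmt5.HS {I : Type} (N : I → ℕ) (m : I → I → ℕ) : Type :=
  ∀ i j : I, Fin (m i j) → Matrix (Fin (N i)) (Fin (N j)) ℂ

/-- The action of `A` on `H` by left block multiplication. -/
def Stmt5.act {I : Type} {N : I → ℕ} {m : I → I → ℕ}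
    (a : Stmt5.AS N) (h : Stmt5.HS N m) : Stmt5.HS N m :=
  fun i j α => a i * h i j α

/-- The conjugate-linear map `J` on `H`: `(J h)_{(i,j,α)} = s i j α • (h_{(j,i,α)})ᴴ`. -/
def Stmt5.Jmap {I : Type} {N : I → ℕ} {m : I → I → ℕ} (hm : ∀ i j, m i j = m j i)
    (s : ∀ i j : I, Fin (m i j) → ℂ) (h : Stmt5.HS N m) : Stmt5.HS N m :=
  fun i j α => s i j α • (h j i (Fin.cast (hm i j) α))ᴴ

/-- `A_J = {a ∈ A : a · (J h) = J ((star a) · h) for all h}`. -/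
def Stmt5.AJ {I : Type} (N : I → ℕ) (m : I → I → ℕ) (hm : ∀ i j, m i j = m j i)
    (s : ∀ i j : I, Fin (m i j) → ℂ) : Set (Stmt5.AS N) :=
  {a | ∀ h : Stmt5.HS N m,
    Stmt5.act a (Stmt5.Jmap hm s h) = Stmt5.Jmap hm s (Stmt5.act (fun i => (a i)ᴴ) h)}

/-- The `*`-homomorphism from functions on the quotient `I/∼` into `A`,
`μ ↦ (i ↦ μ [i] • 1)`, where `∼` is the equivalence relation generated by `m i j ≠ 0`. -/
def Stmt5.Psi {I : Type} (N : I → ℕ) (m : I → I → ℕ)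
    (μ : Quotient (Relation.EqvGen.setoid fun i j => m i j ≠ 0) → ℂ) : Stmt5.AS N :=
  fun i => μ (Quotient.mk (Relation.EqvGen.setoid fun i j => m i j ≠ 0) i) •
    (1 : Matrix (Fin (N i)) (Fin (N i)) ℂ)

theorem Stmt5.mem_AJ_iff {I : Type} (N : I → ℕ) (m : I → I → ℕ) (hm : ∀ i j, m i j = m j i)
    (s : ∀ i j : I, Fin (m i j) → ℂ) (hs : ∀ i j α, s i j α = 1 ∨ s i j α = -1)
    (a : Stmt5.AS N) :
    a ∈ Stmt5.AJ N m hm s ↔ ∀ i j, m i j ≠ 0 →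
      ∀ T : Matrix (Fin (N i)) (Fin (N j)) ℂ, a i * T = T * a j := by
  classical
  constructor
  · intro ha i j hij T
    let α : Fin (m i j) := ⟨0, Nat.pos_of_ne_zero hij⟩
    let h : Stmt5.HS N m := fun k l _ =>
      if hk : k = j ∧ l = i then
        (Tᴴ).submatrix (Fin.cast (by rw [hk.1])) (Fin.cast (by rw [hk.2])) else 0
    have hh : ∀ β, h j i β = Tᴴ := by
      intro β
      simp only [h, and_self, dite_true]
      rfl
    have h1 := congrFun (congrFun (congrFun (ha h) i) j) α
    simp only [Stmt5.act, Stmt5.Jmap, hh, Matrix.conjTranspose_mul,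
      Matrix.conjTranspose_conjTranspose] at h1
    rcases hs i j α with h2 | h2 <;> rw [h2] at h1 <;> simpa using h1
  · intro H h
    funext i j α
    have hij : m i j ≠ 0 := by
      have := α.2
      omega
    simp only [Stmt5.act, Stmt5.Jmap, Matrix.conjTranspose_mul,
      Matrix.conjTranspose_conjTranspose, Matrix.mul_smul]
    rw [H i j hij]

theorem Stmt5.intertwine {n k : ℕ} (hn : 0 < n) (hk : 0 < k)
    (A : Matrix (Fin n) (Fin n) ℂ) (B : Matrix (Fin k) (Fin k) ℂ)
    (H : ∀ T : Matrix (Fin n) (Fin k) ℂ, A * T = T * B) :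
    ∃ c : ℂ, A = c • 1 ∧ B = c • 1 := by
  have key : ∀ (p p' : Fin n) (q q' : Fin k),
      (if q = q' then A p' p else 0) = if p = p' then B q q' else 0 := by
    intro p p' q q'
    have := congrFun (congrFun (H (Matrix.of fun x y => if x = p ∧ y = q then 1 else 0)) p') q'
    simp only [Matrix.mul_apply, Matrix.of_apply, ite_and, mul_ite, mul_one, mul_zero, ite_mul,
      one_mul, zero_mul, Finset.sum_ite_eq', Finset.mem_univ, if_true, eq_comm (a := q'),
      eq_comm (a := p')] at this
    by_cases hp : p = p' <;> by_cases hq : q = q' <;> simp_all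
  refine ⟨A ⟨0, hn⟩ ⟨0, hn⟩, ?_, ?_⟩
  · ext x y
    have h1 := key y x ⟨0, hk⟩ ⟨0, hk⟩
    have h2 := key ⟨0, hn⟩ ⟨0, hn⟩ ⟨0, hk⟩ ⟨0, hk⟩
    by_cases hxy : x = y
    · subst hxy; simp_all
    · simp_all [Matrix.one_apply, eq_comm (a := y)]
  · ext x y
    have h1 := key ⟨0, hn⟩ ⟨0, hn⟩ x y
    by_cases hxy : x = y
    · subst hxy; simp_all
    · simp only [hxy, if_false, if_true] at h1
      simp [Matrix.one_apply, hxy, ← h1]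

theorem Stmt5.range_eq {I : Type} (N : I → ℕ) (hN : ∀ i, 0 < N i)
    (m : I → I → ℕ) (hm : ∀ i j, m i j = m j i) (hfaith : ∀ i, ∃ j, m i j ≠ 0)
    (s : ∀ i j : I, Fin (m i j) → ℂ) (hs : ∀ i j α, s i j α = 1 ∨ s i j α = -1) :
    Set.range (Stmt5.Psi N m) = Stmt5.AJ N m hm s := by
  ext a
  rw [Stmt5.mem_AJ_iff N m hm s hs]
  constructor
  · rintro ⟨μ, rfl⟩ i j hij T
    have : Quotient.mk (Relation.EqvGen.setoid fun i j => m i j ≠ 0) i =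
        Quotient.mk (Relation.EqvGen.setoid fun i j => m i j ≠ 0) j :=
      Quotient.sound (Relation.EqvGen.rel i j hij)
    simp [Stmt5.Psi, this]
  · intro H
    have hc : ∀ i, ∃ c : ℂ, a i = c • 1 := by
      intro i
      obtain ⟨j, hj⟩ := hfaith i
      obtain ⟨c, h, -⟩ := Stmt5.intertwine (hN i) (hN j) _ _ (H i j hj)
      exact ⟨c, h⟩
    choose c hc using hc
    have hrel : ∀ i j, m i j ≠ 0 → c i = c j := by
      intro i j hij
      obtain ⟨d, h1, h2⟩ := Stmt5.intertwine (hN i) (hN j) _ _ (H i j hij)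
      have e1 := congrFun (congrFun ((hc i).symm.trans h1) ⟨0, hN i⟩) ⟨0, hN i⟩
      have e2 := congrFun (congrFun ((hc j).symm.trans h2) ⟨0, hN j⟩) ⟨0, hN j⟩
      simp at e1 e2
      rw [e1, e2]
    have hgen : ∀ i j, Relation.EqvGen (fun i j => m i j ≠ 0) i j → c i = c j := by
      intro i j h
      induction h with
      | rel x y h => exact hrel x y h
      | refl x => rfl
      | symm x y _ ih => exact ih.symm
      | trans x y z _ _ ih1 ih2 => exact ih1.trans ih2
    refine ⟨Quotient.lift c hgen, ?_⟩
    funext i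
    simp [Stmt5.Psi, hc i]

/-- **Corollary 5.1 of the paper.**  `A_J` is isomorphic as a complex `*`-algebra to the
functions on the quotient `I/∼`, via `μ ↦ (i ↦ μ [i] • 1)`; in particular `A_J` equals the
center of `A` iff `m i j = 0` for all `i ≠ j`, and `A_J` equals the scalars `ℂ·1` iff all
indices are equivalent. -/
theorem stmt_5 {I : Type} [Fintype I] [Nonempty I] (N : I → ℕ) (hN : ∀ i, 0 < N i)
    (m : I → I → ℕ) (hm : ∀ i j, m i j = m j i) (hfaith : ∀ i, ∃ j, m i j ≠ 0)
    (s : ∀ i j : I, Fin (m i j) → ℂ) (hs : ∀ i j α, s i j α = 1 ∨ s i j α = -1) :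
    Function.Injective (Stmt5.Psi N m) ∧
    Set.range (Stmt5.Psi N m) = Stmt5.AJ N m hm s ∧
    (∀ μ ν, Stmt5.Psi N m (μ + ν) = Stmt5.Psi N m μ + Stmt5.Psi N m ν) ∧
    (∀ μ ν, Stmt5.Psi N m (μ * ν) = Stmt5.Psi N m μ * Stmt5.Psi N m ν) ∧
    (∀ (c : ℂ) μ, Stmt5.Psi N m (c • μ) = c • Stmt5.Psi N m μ) ∧
    (∀ μ, Stmt5.Psi N m (star μ) = star (Stmt5.Psi N m μ)) ∧
    Stmt5.Psi N m 1 = 1 ∧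
    (Stmt5.AJ N m hm s = {a : Stmt5.AS N | ∀ b : Stmt5.AS N, a * b = b * a} ↔
      ∀ i j, i ≠ j → m i j = 0) ∧
    (Stmt5.AJ N m hm s =
        {a : Stmt5.AS N | ∃ c : ℂ, ∀ i, a i = c • (1 : Matrix (Fin (N i)) (Fin (N i)) ℂ)} ↔
      ∀ i j, Relation.EqvGen (fun i j => m i j ≠ 0) i j) := by
  classical
  have hR := Stmt5.range_eq N hN m hm hfaith s hs
  have hinj : Function.Injective (Stmt5.Psi N m) := by
    intro μ ν h
    funext q
    induction q using Quotient.inductionOn with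
    | h i =>
      have := congrFun (congrFun (congrFun h i) ⟨0, hN i⟩) ⟨0, hN i⟩
      simpa [Stmt5.Psi] using this
  refine ⟨hinj, hR, ?_, ?_, ?_, ?_, ?_, ?_, ?_⟩
  · intro μ ν
    funext i
    simp [Stmt5.Psi, add_smul]
  · intro μ ν
    funext i
    simp [Stmt5.Psi, smul_smul, mul_comm]
  · intro c μ
    funext i
    simp [Stmt5.Psi, smul_smul]
  · intro μ
    funext i
    simp [Stmt5.Psi]
  · funext i
    simp [Stmt5.Psi]
  · constructor
    · intro h i j hij
      by_contra hne
      have hmem : (Pi.single i 1 : Stmt5.AS N) ∈ Stmt5.AJ N m hm s := by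
        rw [h]
        intro b
        funext k
        by_cases hk : k = i
        · subst hk; simp
        · simp [hk]
      rw [Stmt5.mem_AJ_iff N m hm s hs] at hmem
      have h1 := hmem i j hne (Matrix.of fun _ _ => 1)
      have h2 := congrFun (congrFun h1 ⟨0, hN i⟩) ⟨0, hN j⟩
      simp [Ne.symm hij] at h2
    · intro h
      ext a
      rw [Stmt5.mem_AJ_iff N m hm s hs]
      constructor
      · intro H b
        funext i
        obtain ⟨j, hj⟩ := hfaith i
        have hij : i = j := by
          by_contra hne
          exact hj (h i j hne)
        subst hij
        exact H i i hj (b i)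
      · intro H i j hij T
        have hij' : i = j := by
          by_contra hne
          exact hij (h i j hne)
        subst hij'
        have := congrFun (H (Pi.single i T)) i
        simpa using this
  · constructor
    · intro h i j
      have hmem : Stmt5.Psi N m (fun q => if q = Quotient.mk _ i then 1 else 0) ∈
          Stmt5.AJ N m hm s := by
        rw [← hR]
        exact ⟨_, rfl⟩
      rw [h] at hmem
      obtain ⟨c, hc⟩ := hmem
      have h1 := congrFun (congrFun (hc i) ⟨0, hN i⟩) ⟨0, hN i⟩
      have h2 := congrFun (congrFun (hc j) ⟨0, hN j⟩) ⟨0, hN j⟩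
      by_cases hq : Quotient.mk (Relation.EqvGen.setoid fun i j => m i j ≠ 0) j = Quotient.mk _ i
      · exact (Quotient.exact hq).symm
      · simp only [Stmt5.Psi, hq, if_true, if_false, Matrix.smul_apply, Matrix.one_apply_eq,
          smul_eq_mul, mul_one] at h1 h2
        exact absurd (h1.trans h2.symm) one_ne_zero
    · intro h
      rw [← hR]
      ext a
      constructor
      · rintro ⟨μ, rfl⟩
        obtain ⟨i₀⟩ := ‹Nonempty I›
        refine ⟨μ (Quotient.mk _ i₀), fun i => ?_⟩
        have : Quotient.mk (Relation.EqvGen.setoid fun i j => m i j ≠ 0) i = Quotient.mk _ i₀ :=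
          Quotient.sound (h i i₀)
        simp only [Stmt5.Psi, this]
      · rintro ⟨c, hc⟩
        refine ⟨fun _ => c, ?_⟩
        funext i
        simp only [Stmt5.Psi, hc i]

end
end

section
/- With the setup below, the map Φ : 𝒰(A) → B(H) defined by Φ(u) := u ∘ (J ∘ u ∘ J⁻¹) is a group homomorphism from the unitary group 𝒰(A) into the group of unitary operators on H, and its kernel is exactly 𝒰(A) ∩ A_J. Consequently the gauge group 𝒢 := {u ∘ J ∘ u ∘ J⁻¹ : u ∈ 𝒰(A)} is a subgroup of the unitary group of H, and 𝒢 is isomorphic as a group to the quotient 𝒰(A)/𝒰(A_J), where 𝒰(A_J) := 𝒰(A) ∩ A_J is a normal subgroup of 𝒰(A). -/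
noncomputable section

/-- **The gauge group of a real spectral triple (equations (1.2)/(3.1) of the paper).**
Let `H` be a complex Hilbert space, `A` a unital `*`-subalgebra of `B(H)`, `J` an
antiunitary on `H` satisfying the order-zero condition, and let `Jc u = J ∘ u ∘ J⁻¹`
(given as data, with its characterizing property).  With `𝒰(A)` the unitaries of `A` and
`A_J = {a ∈ A : a ∘ J = J ∘ a*}`, the map `Φ : u ↦ u ∘ J ∘ u ∘ J⁻¹ = u * Jc u` is a group
homomorphism from `𝒰(A)` into the unitary operators on `H` with kernel `𝒰(A) ∩ A_J`;
hence the gauge group `𝒢 = Φ(𝒰(A))` is a subgroup of the unitary group of `H`,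
isomorphic to `𝒰(A)/𝒰(A_J)` (with `𝒰(A_J)` normal in `𝒰(A)`). -/
theorem stmt_6 {H : Type*} [NormedAddCommGroup H] [InnerProductSpace ℂ H] [CompleteSpace H]
    (A : StarSubalgebra ℂ (H →L[ℂ] H))
    (J : H ≃ₗᵢ⋆[ℂ] H)
    (Jc : (H →L[ℂ] H) → (H →L[ℂ] H))
    (hJc : ∀ (u : H →L[ℂ] H) (x : H), Jc u x = J (u (J.symm x)))
    (horder : ∀ a ∈ A, ∀ b ∈ A, a * Jc (star b) = Jc (star b) * a) :
    -- `𝒰(A)` is closed under multiplication and star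
    (∀ u ∈ (A : Set (H →L[ℂ] H)) ∩ (unitary (H →L[ℂ] H) : Set (H →L[ℂ] H)), ∀ v ∈ (A : Set (H →L[ℂ] H)) ∩ (unitary (H →L[ℂ] H) : Set (H →L[ℂ] H)),
      u * v ∈ (A : Set (H →L[ℂ] H)) ∩ (unitary (H →L[ℂ] H) : Set (H →L[ℂ] H))) ∧
    (∀ u ∈ (A : Set (H →L[ℂ] H)) ∩ (unitary (H →L[ℂ] H) : Set (H →L[ℂ] H)), star u ∈ (A : Set (H →L[ℂ] H)) ∩ (unitary (H →L[ℂ] H) : Set (H →L[ℂ] H))) ∧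
    -- `Φ` maps into the unitary operators on `H`
    (∀ u ∈ (A : Set (H →L[ℂ] H)) ∩ (unitary (H →L[ℂ] H) : Set (H →L[ℂ] H)), u * Jc u ∈ unitary (H →L[ℂ] H)) ∧
    -- `Φ` is a group homomorphism
    (∀ u ∈ (A : Set (H →L[ℂ] H)) ∩ (unitary (H →L[ℂ] H) : Set (H →L[ℂ] H)), ∀ v ∈ (A : Set (H →L[ℂ] H)) ∩ (unitary (H →L[ℂ] H) : Set (H →L[ℂ] H)),
      (u * v) * Jc (u * v) = (u * Jc u) * (v * Jc v)) ∧
    -- `Φ u⁻¹` is inverse to `Φ u`, so `𝒢` is a subgroup of the unitary group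
    (∀ u ∈ (A : Set (H →L[ℂ] H)) ∩ (unitary (H →L[ℂ] H) : Set (H →L[ℂ] H)), (star u * Jc (star u)) * (u * Jc u) = 1) ∧
    -- the kernel of `Φ` is exactly `𝒰(A) ∩ A_J`
    (∀ u ∈ (A : Set (H →L[ℂ] H)) ∩ (unitary (H →L[ℂ] H) : Set (H →L[ℂ] H)),
      (u * Jc u = 1 ↔ ∀ x, u (J x) = J ((star u) x))) ∧
    -- `𝒰(A_J)` is a normal subgroup of `𝒰(A)`
    (∀ u ∈ (A : Set (H →L[ℂ] H)) ∩ (unitary (H →L[ℂ] H) : Set (H →L[ℂ] H)), ∀ w ∈ (A : Set (H →L[ℂ] H)) ∩ (unitary (H →L[ℂ] H) : Set (H →L[ℂ] H)),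
      (∀ x, w (J x) = J ((star w) x)) →
        u * w * star u ∈ (A : Set (H →L[ℂ] H)) ∩ (unitary (H →L[ℂ] H) : Set (H →L[ℂ] H)) ∧
          ∀ x, (u * w * star u) (J x) = J ((star (u * w * star u)) x)) ∧
    -- first isomorphism theorem: `Φ u = Φ v` iff `v⁻¹ u ∈ 𝒰(A_J)`,
    -- so `𝒢 ≅ 𝒰(A)/𝒰(A_J)`
    (∀ u ∈ (A : Set (H →L[ℂ] H)) ∩ (unitary (H →L[ℂ] H) : Set (H →L[ℂ] H)), ∀ v ∈ (A : Set (H →L[ℂ] H)) ∩ (unitary (H →L[ℂ] H) : Set (H →L[ℂ] H)),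
      (u * Jc u = v * Jc v ↔ ∀ x, (star v * u) (J x) = J ((star (star v * u)) x))) := by
  have Jmul : ∀ a b : H →L[ℂ] H, Jc (a * b) = Jc a * Jc b := by
    intro a b; ext x; simp [hJc]
  have Jone : Jc 1 = 1 := by ext x; simp [hJc]
  have comm : ∀ a ∈ A, ∀ b ∈ A, a * Jc b = Jc b * a := by
    intro a ha b hb
    have := horder a ha (star b) (star_mem hb)
    rwa [star_star] at this
  have cond : ∀ u : H →L[ℂ] H, (∀ x, u (J x) = J ((star u) x)) ↔ u = Jc (star u) := by
    intro u
    constructor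
    · intro h
      ext x
      have := h (J.symm x)
      rw [hJc, ← this, J.apply_symm_apply]
    · intro h x
      have := hJc (star u) (J x)
      rw [← h, J.symm_apply_apply] at this
      exact this
  have Jl : ∀ u ∈ unitary (H →L[ℂ] H), Jc (star u) * Jc u = 1 := by
    intro u hu
    rw [← Jmul, Unitary.star_mul_self_of_mem hu, Jone]
  have Jr : ∀ u ∈ unitary (H →L[ℂ] H), Jc u * Jc (star u) = 1 := by
    intro u hu
    rw [← Jmul, Unitary.mul_star_self_of_mem hu, Jone]
  have Juni : ∀ u ∈ unitary (H →L[ℂ] H), Jc u ∈ unitary (H →L[ℂ] H) := by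
    intro u hu
    have hn : ∀ x, ‖u x‖ = ‖x‖ :=
      (ContinuousLinearMap.norm_map_iff_adjoint_comp_self u).2 (Unitary.star_mul_self_of_mem hu)
    have h1 : star (Jc u) * Jc u = 1 :=
      (ContinuousLinearMap.norm_map_iff_adjoint_comp_self (Jc u)).1 (by
        intro x; rw [hJc, J.norm_map, hn, J.symm.norm_map])
    have h2 : star (Jc u) = Jc (star u) := left_inv_eq_right_inv h1 (Jr u hu)
    exact Unitary.mem_iff.2 ⟨h1, by rw [h2, Jr u hu]⟩
  have Umul : ∀ u ∈ (A : Set (H →L[ℂ] H)) ∩ (unitary (H →L[ℂ] H) : Set (H →L[ℂ] H)), ∀ v ∈ (A : Set (H →L[ℂ] H)) ∩ (unitary (H →L[ℂ] H) : Set (H →L[ℂ] H)),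
      u * v ∈ (A : Set (H →L[ℂ] H)) ∩ (unitary (H →L[ℂ] H) : Set (H →L[ℂ] H)) :=
    fun u hu v hv => ⟨A.mul_mem hu.1 hv.1, (unitary _).mul_mem hu.2 hv.2⟩
  have Ustar : ∀ u ∈ (A : Set (H →L[ℂ] H)) ∩ (unitary (H →L[ℂ] H) : Set (H →L[ℂ] H)), star u ∈ (A : Set (H →L[ℂ] H)) ∩ (unitary (H →L[ℂ] H) : Set (H →L[ℂ] H)) :=
    fun u hu => ⟨A.star_mem' hu.1, Unitary.star_mem hu.2⟩
  have hom : ∀ u ∈ (A : Set (H →L[ℂ] H)) ∩ (unitary (H →L[ℂ] H) : Set (H →L[ℂ] H)), ∀ v ∈ (A : Set (H →L[ℂ] H)) ∩ (unitary (H →L[ℂ] H) : Set (H →L[ℂ] H)),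
      (u * v) * Jc (u * v) = (u * Jc u) * (v * Jc v) := by
    intro u hu v hv
    rw [Jmul, mul_assoc, ← mul_assoc v, comm v hv.1 u hu.1]
    simp only [mul_assoc]
  have inv : ∀ u ∈ (A : Set (H →L[ℂ] H)) ∩ (unitary (H →L[ℂ] H) : Set (H →L[ℂ] H)), (star u * Jc (star u)) * (u * Jc u) = 1 := by
    intro u hu
    rw [← hom _ (Ustar u hu) u hu, Unitary.star_mul_self_of_mem hu.2, Jone, one_mul]
  have ker : ∀ u ∈ (A : Set (H →L[ℂ] H)) ∩ (unitary (H →L[ℂ] H) : Set (H →L[ℂ] H)),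
      (u * Jc u = 1 ↔ ∀ x, u (J x) = J ((star u) x)) := by
    intro u hu
    rw [cond]
    constructor
    · intro h
      exact left_inv_eq_right_inv h (Jr u hu.2)
    · intro h
      have := Jl u hu.2
      rwa [← h] at this
  have inv' : ∀ u ∈ (A : Set (H →L[ℂ] H)) ∩ (unitary (H →L[ℂ] H) : Set (H →L[ℂ] H)), (u * Jc u) * (star u * Jc (star u)) = 1 := by
    intro u hu
    have := inv _ (Ustar u hu)
    rwa [star_star] at this
  refine ⟨Umul, Ustar, fun u hu => (unitary _).mul_mem hu.2 (Juni u hu.2), hom, inv, ker, ?_, ?_⟩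
  · intro u hu w hw h
    have hm := Umul _ (Umul u hu w hw) _ (Ustar u hu)
    refine ⟨hm, (ker _ hm).1 ?_⟩
    rw [hom _ (Umul u hu w hw) _ (Ustar u hu), hom u hu w hw, (ker w hw).2 h, mul_one, inv' u hu]
  · intro u hu v hv
    rw [← ker _ (Umul _ (Ustar v hv) u hu), hom _ (Ustar v hv) u hu]
    constructor
    · intro h
      rw [h, inv v hv]
    · intro h
      exact (left_inv_eq_right_inv (inv' v hv) h).symm

end
end

section
/- Let R be a commutative ring, Ω an R-module, and d : R → Ω a derivation such that Ω is generated as an R-module by the image of d. Let B be a unital associative R-algebra and let ∇ : B → B ⊗[R] Ω be an additive map satisfying the connection Leibniz rule ∇(r • b) = r • ∇(b) + b ⊗ₜ d r for all b ∈ B and r ∈ R, and satisfying ∇(1) = 0. Regard B ⊗[R] Ω as a left B-module via multiplication on the first tensor factor. Then the additive subgroup of B ⊗[R] Ω generated by the elements a • ∇(b), for a, b ∈ B, is all of B ⊗[R] Ω; i.e. every element of B ⊗[R] Ω is a finite sum Σ_j a_j • ∇(b_j) with a_j, b_j ∈ B. -/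
open scoped TensorProduct

/-- **Lemma 7.3 of the paper (algebraic content).**
Let `R` be a commutative ring, `Ω` an `R`-module generated by the image of a derivation
`d : R → Ω`, `B` a unital `R`-algebra, and `∇ : B → B ⊗[R] Ω` an additive map satisfying
the Leibniz rule `∇(r • b) = r • ∇ b + b ⊗ d r` and `∇ 1 = 0`.  Then the additive
subgroup of `B ⊗[R] Ω` generated by the elements `a • ∇ b` (with the left `B`-module
structure on the first tensor factor) is all of `B ⊗[R] Ω`. -/
theorem stmt_9 {R : Type*} [CommRing R] {Ω : Type*} [AddCommGroup Ω] [Module R Ω]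
    (d : R → Ω) (hd_add : ∀ r s : R, d (r + s) = d r + d s)
    (hd_leibniz : ∀ r s : R, d (r * s) = r • d s + s • d r)
    (hd_gen : Submodule.span R (Set.range d) = ⊤)
    {B : Type*} [Ring B] [Algebra R B]
    (nab : B → B ⊗[R] Ω) (hnab_add : ∀ a b : B, nab (a + b) = nab a + nab b)
    (hnab_leibniz : ∀ (r : R) (b : B), nab (r • b) = r • nab b + b ⊗ₜ[R] d r)
    (hnab_one : nab 1 = 0) :
    AddSubgroup.closure {x : B ⊗[R] Ω | ∃ a b : B, x = a • nab b} = ⊤ := by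
  rw [eq_top_iff]
  rintro x -
  have key : ∀ w : Ω, ∀ a : B, a ⊗ₜ[R] w ∈
      AddSubgroup.closure {x : B ⊗[R] Ω | ∃ a b : B, x = a • nab b} := by
    intro w
    have hw : w ∈ Submodule.span R (Set.range d) := by rw [hd_gen]; trivial
    induction hw using Submodule.span_induction with
    | mem w h =>
      obtain ⟨r, rfl⟩ := h
      intro a
      refine AddSubgroup.subset_closure ⟨a, r • 1, ?_⟩
      rw [hnab_leibniz, hnab_one, smul_zero, zero_add, TensorProduct.smul_tmul', smul_eq_mul,
        mul_one]
    | zero => intro a; rw [TensorProduct.tmul_zero]; exact zero_mem _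
    | add x y _ _ hx hy => intro a; rw [TensorProduct.tmul_add]; exact add_mem (hx a) (hy a)
    | smul r x _ hx => intro a; rw [← TensorProduct.smul_tmul]; exact hx _
  induction x using TensorProduct.induction_on with
  | zero => exact zero_mem _
  | tmul a w => exact key w a
  | add x y hx hy => exact add_mem hx hy
end

section
/- With the setup below, the set of unitaries {u ∈ 𝒰(A) : (for all i, j with m i j ≠ 0 and all t ∈ Matrix (Fin (N i)) (Fin (N j)) ℂ, (u i) * t * (u j)ᴴ = t) and (for every equivalence class c of ∼, det_c(u) = 1)} is finite. -/
open Matrix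

noncomputable section

namespace Stmt11

variable {I : Type} {N : I → ℕ} {m : I → I → ℕ}

/-- The algebra `A = Π_{i} M_{N i}(ℂ)`. -/
abbrev AS (N : I → ℕ) : Type :=
  ∀ i : I, Matrix (Fin (N i)) (Fin (N i)) ℂ

/-- The Hilbert space `H = ⊕_{i j} ⊕_{α < m i j} M_{N i, N j}(ℂ)`. -/
abbrev HS (N : I → ℕ) (m : I → I → ℕ) : Type :=
  ∀ i j : I, Fin (m i j) → Matrix (Fin (N i)) (Fin (N j)) ℂ

/-- The action of `a ∈ A` on `H` by left block multiplication, as a `ℂ`-linear map. -/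
def actL (N : I → ℕ) (m : I → I → ℕ) (a : AS N) : HS N m →ₗ[ℂ] HS N m where
  toFun h := fun i j α => a i * h i j α
  map_add' h h' := by
    funext i j α
    show a i * (h i j α + h' i j α) = a i * h i j α + a i * h' i j α
    rw [Matrix.mul_add]
  map_smul' c h := by
    funext i j α
    show a i * (c • h i j α) = c • (a i * h i j α)
    rw [Matrix.mul_smul]

/-- The subspace `H_c ⊆ H` of elements supported on the summands `(i,j,α)` with `i ∈ c`. -/
def Hc (N : I → ℕ) (m : I → I → ℕ) (c : Set I) : Submodule ℂ (HS N m) where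
  carrier := {h | ∀ i, i ∉ c → ∀ j α, h i j α = 0}
  add_mem' := by
    intro h h' hh hh' i hi j α
    show h i j α + h' i j α = 0
    rw [hh i hi j α, hh' i hi j α, add_zero]
  zero_mem' := by intro i _ j α; rfl
  smul_mem' := by
    intro t h hh i hi j α
    show t • h i j α = 0
    rw [hh i hi j α, smul_zero]

/-- The action of `a ∈ A` preserves `H_c`. -/
theorem actL_mem_Hc (N : I → ℕ) (m : I → I → ℕ) (c : Set I) (a : AS N) :
    ∀ h ∈ Hc N m c, actL N m a h ∈ Hc N m c := by
  intro h hh i hi j α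
  show a i * h i j α = 0
  rw [hh i hi j α, Matrix.mul_zero]

/-- `det_c a`: the determinant of the endomorphism `h ↦ a · h` of the subspace `H_c`. -/
def detc (N : I → ℕ) (m : I → I → ℕ) (c : Set I) (a : AS N) : ℂ :=
  LinearMap.det ((actL N m a).restrict (actL_mem_Hc N m c a))

end Stmt11

/-- If `a t bᴴ = t` for all `t` and `b` is unitary, then `a` is scalar, with value any diagonal
entry of `b`. -/
theorem Stmt11.scalar_aux {p q : ℕ} (a : Matrix (Fin p) (Fin p) ℂ) (b : Matrix (Fin q) (Fin q) ℂ)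
    (hb : star b * b = 1) (h : ∀ t : Matrix (Fin p) (Fin q) ℂ, a * t * bᴴ = t) (d : Fin q) :
    a = b d d • (1 : Matrix (Fin p) (Fin p) ℂ) := by
  have h' : ∀ t : Matrix (Fin p) (Fin q) ℂ, a * t = t * b := by
    intro t
    have h1 := congrArg (fun x => x * b) (h t)
    simp only [Matrix.mul_assoc] at h1
    rw [← Matrix.star_eq_conjTranspose, hb, Matrix.mul_one] at h1
    exact h1
  ext x y
  have h2 := congrFun (congrFun (h' (Matrix.single y d 1)) x) d
  rw [Matrix.mul_single_apply_same] at h2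
  by_cases hxy : x = y
  · subst hxy
    rw [Matrix.single_mul_apply_same] at h2
    simpa using h2
  · rw [Matrix.single_mul_apply_of_ne _ _ _ _ _ hxy] at h2
    simpa [hxy] using h2

/-- **Finiteness of the fibres of the covering in Proposition 5.2 of the paper.**
The set of unitaries `u ∈ 𝒰(A)` which lie in the kernel of `u ↦ u J u J⁻¹` (i.e.
`(u i) t (u j)ᴴ = t` for all `t` whenever `m i j ≠ 0`) and satisfy `det_c u = 1` for every
equivalence class `c` of `∼` is finite. -/
theorem stmt_11 {I : Type} [Fintype I] [Nonempty I] (N : I → ℕ) (hN : ∀ i, 0 < N i)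
    (m : I → I → ℕ) (hm : ∀ i j, m i j = m j i) (hfaith : ∀ i, ∃ j, m i j ≠ 0) :
    Set.Finite {u : Stmt11.AS N |
      (∀ i, star (u i) * u i = 1 ∧ u i * star (u i) = 1) ∧
      (∀ i j, m i j ≠ 0 → ∀ t : Matrix (Fin (N i)) (Fin (N j)) ℂ, u i * t * (u j)ᴴ = t) ∧
      (∀ i : I, Stmt11.detc N m {j | Relation.EqvGen (fun a b => m a b ≠ 0) i j} u = 1)} := by
  classical
  let z : ∀ i, Fin (N i) := fun i => ⟨0, hN i⟩
  let c : I → Set I := fun i => {j | Relation.EqvGen (fun a b => m a b ≠ 0) i j}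
  let F : (I → ℂ) → Stmt11.AS N := fun l i => l i • 1
  let d : I → ℕ := fun i => Module.finrank ℂ (Stmt11.Hc N m (c i))
  have hd : ∀ i, 0 < d i := by
    intro i
    obtain ⟨j, hj⟩ := hfaith i
    have : Nontrivial (Stmt11.Hc N m (c i)) := by
      let h : Stmt11.HS N m := fun i' _ _ => if i' = i then fun _ _ => 1 else 0
      have hh : h ∈ Stmt11.Hc N m (c i) := by
        intro i' hi' j α
        have : i' ≠ i := by
          rintro rfl
          exact hi' (Relation.EqvGen.refl _)
        simp [h, this]
      refine ⟨⟨⟨h, hh⟩, 0, ?_⟩⟩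
      intro e
      have e1 := congrArg Subtype.val e
      have e2 := congrFun (congrFun (congrFun (congrFun (congrFun e1 i) j)
        ⟨0, Nat.pos_of_ne_zero hj⟩) (z i)) (z j)
      simp [h] at e2
    exact Module.finrank_pos
  have hfin : Set.Finite (F '' (Set.univ.pi fun i => {w : ℂ | w ^ d i = 1})) := by
    refine Set.Finite.image _ (Set.Finite.pi fun i => ?_)
    refine (Polynomial.nthRootsFinset (d i) (1 : ℂ)).finite_toSet.subset ?_
    intro w hw
    simpa [Polynomial.mem_nthRootsFinset (hd i)] using hw
  refine hfin.subset ?_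
  rintro u ⟨hu, hk, hdet⟩
  have hs : ∀ i, u i = u i (z i) (z i) • (1 : Matrix (Fin (N i)) (Fin (N i)) ℂ) := by
    intro i
    obtain ⟨j, hj⟩ := hfaith i
    have h1 := Stmt11.scalar_aux (u i) (u j) (hu j).1 (hk i j hj) (z j)
    have h2 := congrFun (congrFun h1 (z i)) (z i)
    simp at h2
    rw [h2]
    exact h1
  have hc : ∀ i j, Relation.EqvGen (fun a b => m a b ≠ 0) i j →
      u i (z i) (z i) = u j (z j) (z j) := by
    intro i j hij
    induction hij with
    | rel i j hj =>
      have h1 := Stmt11.scalar_aux (u i) (u j) (hu j).1 (hk i j hj) (z j)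
      have h2 := congrFun (congrFun h1 (z i)) (z i)
      simpa using h2
    | refl => rfl
    | symm _ _ _ ih => exact ih.symm
    | trans _ _ _ _ _ ih1 ih2 => exact ih1.trans ih2
  refine ⟨fun i => u i (z i) (z i), ?_, ?_⟩
  · intro i _
    have h1 := hdet i
    unfold Stmt11.detc at h1
    have h2 : (Stmt11.actL N m u).restrict (Stmt11.actL_mem_Hc N m (c i) u)
        = u i (z i) (z i) • LinearMap.id := by
      ext1 ⟨h, hh⟩
      apply Subtype.ext
      funext i' j α
      show u i' * h i' j α = u i (z i) (z i) • h i' j α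
      by_cases hi : i' ∈ c i
      · rw [hc i i' hi]
        conv_lhs => rw [hs i']
        rw [Matrix.smul_mul, Matrix.one_mul]
      · rw [hh i' hi j α, Matrix.mul_zero, smul_zero]
    rw [h2, LinearMap.det_smul, LinearMap.det_id, mul_one] at h1
    exact h1
  · funext i
    exact (hs i).symm
end
end

section
/- With the setup below, every unitary u ∈ 𝒰(A) can be written as a product u = v · w, where v, w ∈ 𝒰(A), det_c(v) = 1 for every equivalence class c of ∼, and w ∈ A_J (that is, each w i is a unimodular scalar multiple λ_i • 1 of the identity matrix with λ_i = λ_j whenever i ∼ j). -/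
open Matrix

noncomputable section

namespace Stmt12

variable {I : Type} {N : I → ℕ} {m : I → I → ℕ}

/-- The algebra `A = Π_{i} M_{N i}(ℂ)`. -/
abbrev AS (N : I → ℕ) : Type :=
  ∀ i : I, Matrix (Fin (N i)) (Fin (N i)) ℂ

/-- The Hilbert space `H = ⊕_{i j} ⊕_{α < m i j} M_{N i, N j}(ℂ)`. -/
abbrev HS (N : I → ℕ) (m : I → I → ℕ) : Type :=
  ∀ i j : I, Fin (m i j) → Matrix (Fin (N i)) (Fin (N j)) ℂ

/-- The action of `a ∈ A` on `H` by left block multiplication, as a `ℂ`-linear map. -/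
def actL (N : I → ℕ) (m : I → I → ℕ) (a : AS N) : HS N m →ₗ[ℂ] HS N m where
  toFun h := fun i j α => a i * h i j α
  map_add' h h' := by
    funext i j α
    show a i * (h i j α + h' i j α) = a i * h i j α + a i * h' i j α
    rw [Matrix.mul_add]
  map_smul' c h := by
    funext i j α
    show a i * (c • h i j α) = c • (a i * h i j α)
    rw [Matrix.mul_smul]

/-- The subspace `H_c ⊆ H` of elements supported on the summands `(i,j,α)` with `i ∈ c`. -/
def Hc (N : I → ℕ) (m : I → I → ℕ) (c : Set I) : Submodule ℂ (HS N m) where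
  carrier := {h | ∀ i, i ∉ c → ∀ j α, h i j α = 0}
  add_mem' := by
    intro h h' hh hh' i hi j α
    show h i j α + h' i j α = 0
    rw [hh i hi j α, hh' i hi j α, add_zero]
  zero_mem' := by intro i _ j α; rfl
  smul_mem' := by
    intro t h hh i hi j α
    show t • h i j α = 0
    rw [hh i hi j α, smul_zero]

/-- The action of `a ∈ A` preserves `H_c`. -/
theorem actL_mem_Hc (N : I → ℕ) (m : I → I → ℕ) (c : Set I) (a : AS N) :
    ∀ h ∈ Hc N m c, actL N m a h ∈ Hc N m c := by
  intro h hh i hi j α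
  show a i * h i j α = 0
  rw [hh i hi j α, Matrix.mul_zero]

/-- `det_c a`: the determinant of the endomorphism `h ↦ a · h` of the subspace `H_c`. -/
def detc (N : I → ℕ) (m : I → I → ℕ) (c : Set I) (a : AS N) : ℂ :=
  LinearMap.det ((actL N m a).restrict (actL_mem_Hc N m c a))

end Stmt12

namespace Stmt12

open scoped ComplexOrder in
theorem norm_eigen {n k : ℕ} (U : Matrix (Fin n) (Fin n) ℂ) (hU : star U * U = 1)
    (M : Matrix (Fin n) (Fin k) ℂ) (hM : M ≠ 0) (z : ℂ) (h : U * M = z • M) : ‖z‖ = 1 := by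
  have h1 : (U * M)ᴴ * (U * M) = Mᴴ * M := by
    rw [Matrix.conjTranspose_mul, Matrix.mul_assoc, ← Matrix.mul_assoc Uᴴ,
      ← Matrix.star_eq_conjTranspose U, hU, Matrix.one_mul]
  rw [h, Matrix.conjTranspose_smul, Matrix.smul_mul, Matrix.mul_smul, smul_smul] at h1
  have h2 : Mᴴ * M ≠ 0 := fun h0 => hM (Matrix.conjTranspose_mul_self_eq_zero.mp h0)
  have h3 : (star z * z - 1) • (Mᴴ * M) = 0 := by rw [sub_smul, h1, one_smul, sub_self]
  have h4 : star z * z = 1 := by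
    rcases smul_eq_zero.mp h3 with h | h
    · exact sub_eq_zero.mp h
    · exact absurd h h2
  have h5 : ‖z‖ * ‖z‖ = 1 := by
    have := congrArg norm h4
    simpa using this
  nlinarith [norm_nonneg z]

theorem norm_detc {I : Type} [Fintype I] (N : I → ℕ) (m : I → I → ℕ) (c : Set I) (u : AS N)
    (hu : ∀ i, star (u i) * u i = 1) : ‖detc N m c u‖ = 1 := by
  unfold detc
  set T := (actL N m u).restrict (actL_mem_Hc N m c u) with hT
  have key : ∀ z ∈ T.charpoly.roots, ‖z‖ = 1 := by
    intro z hz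
    have hz' := (Module.End.hasEigenvalue_iff_isRoot_charpoly T z).mpr
      (Polynomial.isRoot_of_mem_roots hz)
    obtain ⟨h, hh⟩ := hz'.exists_hasEigenvector
    have e := hh.apply_eq_smul
    have hne := hh.2
    have : ∃ i j α, h.1 i j α ≠ 0 := by
      by_contra! hc
      apply hne
      ext1
      funext i j α
      exact hc i j α
    obtain ⟨i, j, α, hM⟩ := this
    refine norm_eigen (u i) (hu i) _ hM z ?_
    exact congrArg (fun x : Hc N m c => x.1 i j α) e
  have hd : LinearMap.det T = T.charpoly.roots.prod :=
    Module.End.det_eq_prod_roots_charpoly_of_splits (IsAlgClosed.splits _)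
  rw [hd]
  have h2 : ‖T.charpoly.roots.prod‖ = (T.charpoly.roots.map (fun z => ‖z‖)).prod :=
    map_multiset_prod (normHom : ℂ →*₀ ℝ) _
  rw [h2]
  apply Multiset.prod_eq_one
  intro x hx
  obtain ⟨z, hz, rfl⟩ := Multiset.mem_map.mp hx
  exact key z hz

theorem exists_root {I : Type} [Fintype I] (N : I → ℕ) (m : I → I → ℕ) (u : AS N)
    (hu : ∀ i, star (u i) * u i = 1) (c : Set I) :
    ∃ z : ℂ, ‖z‖ = 1 ∧ z ^ (Module.finrank ℂ (Hc N m c)) = detc N m c u := by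
  by_cases hn : Module.finrank ℂ (Hc N m c) = 0
  · refine ⟨1, by simp, ?_⟩
    rw [one_pow]
    exact (LinearMap.det_eq_one_of_finrank_eq_zero hn _).symm
  · obtain ⟨z, hz⟩ := IsAlgClosed.exists_pow_nat_eq (detc N m c u) (Nat.pos_of_ne_zero hn)
    refine ⟨z, ?_, hz⟩
    have := congrArg norm hz
    rw [norm_pow, norm_detc N m c u hu] at this
    exact (pow_eq_one_iff_of_nonneg (norm_nonneg z) hn).mp this

theorem smul_unit {n : ℕ} (U : Matrix (Fin n) (Fin n) ℂ) (z : ℂ) (hz : ‖z‖ = 1)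
    (hU : star U * U = 1 ∧ U * star U = 1) :
    star (z • U) * (z • U) = 1 ∧ (z • U) * star (z • U) = 1 := by
  have h1 : star z * z = 1 := by
    have := Complex.conj_mul' z
    simpa [hz] using this
  constructor
  · rw [star_smul, smul_mul_smul_comm, hU.1, h1, one_smul]
  · rw [star_smul, smul_mul_smul_comm, hU.2, mul_comm, h1, one_smul]

end Stmt12

/-- **Decomposition `u = v w` in the proof of Proposition 5.2 of the paper.**
Every unitary `u ∈ 𝒰(A)` can be written as `u = v · w` with `v, w` unitary,
`det_c v = 1` for every equivalence class `c` of `∼`, and `w ∈ A_J`, i.e. each `w i` is a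
unimodular scalar `λ i • 1` with `λ i = λ j` whenever `i ∼ j`. -/
theorem stmt_12 {I : Type} [Fintype I] [Nonempty I] (N : I → ℕ) (hN : ∀ i, 0 < N i)
    (m : I → I → ℕ) (hm : ∀ i j, m i j = m j i) (hfaith : ∀ i, ∃ j, m i j ≠ 0) :
    ∀ u : Stmt12.AS N, (∀ i, star (u i) * u i = 1 ∧ u i * star (u i) = 1) →
      ∃ v w : Stmt12.AS N,
        (∀ i, star (v i) * v i = 1 ∧ v i * star (v i) = 1) ∧
        (∀ i, star (w i) * w i = 1 ∧ w i * star (w i) = 1) ∧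
        (∀ i : I, Stmt12.detc N m {j | Relation.EqvGen (fun a b => m a b ≠ 0) i j} v = 1) ∧
        (∃ lam : I → ℂ, (∀ i, ‖lam i‖ = 1) ∧
          (∀ i, w i = lam i • (1 : Matrix (Fin (N i)) (Fin (N i)) ℂ)) ∧
          ∀ i j, Relation.EqvGen (fun a b => m a b ≠ 0) i j → lam i = lam j) ∧
        u = fun i => v i * w i := by
  intro u hu
  choose f hf1 hf2 using Stmt12.exists_root N m u (fun i => (hu i).1)
  let cls : I → Set I := fun i => {j | Relation.EqvGen (fun a b => m a b ≠ 0) i j}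
  have hcls : ∀ i j, Relation.EqvGen (fun a b => m a b ≠ 0) i j → cls i = cls j := by
    intro i j hij
    ext k
    exact ⟨fun h => (hij.symm _ _).trans _ _ _ h, fun h => hij.trans _ _ _ h⟩
  have hne : ∀ c, f c ≠ 0 := fun c h0 => by simpa [h0] using hf1 c
  refine ⟨fun i => (f (cls i))⁻¹ • u i, fun i => f (cls i) • 1, ?_, ?_, ?_,
    ⟨fun i => f (cls i), fun i => hf1 _, fun i => rfl,
      fun i j hij => congrArg f (hcls i j hij)⟩, ?_⟩
  · intro i
    exact Stmt12.smul_unit _ _ (by rw [norm_inv, hf1, inv_one]) (hu i)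
  · intro i
    exact Stmt12.smul_unit _ _ (hf1 _) (by simp)
  · intro i
    change Stmt12.detc N m (cls i) _ = 1
    have h1 : (Stmt12.actL N m (fun i => (f (cls i))⁻¹ • u i)).restrict
        (Stmt12.actL_mem_Hc N m (cls i) _) = (f (cls i))⁻¹ •
        (Stmt12.actL N m u).restrict (Stmt12.actL_mem_Hc N m (cls i) u) := by
      apply LinearMap.ext
      intro h
      apply Subtype.ext
      funext k j α
      change ((f (cls k))⁻¹ • u k) * h.1 k j α = (f (cls i))⁻¹ • (u k * h.1 k j α)
      by_cases hk : k ∈ cls i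
      · rw [← hcls i k hk, Matrix.smul_mul]
      · rw [h.2 k hk j α, Matrix.mul_zero, Matrix.mul_zero, smul_zero]
    unfold Stmt12.detc
    rw [h1, LinearMap.det_smul]
    change _ * Stmt12.detc N m (cls i) u = 1
    rw [← hf2, ← mul_pow, inv_mul_cancel₀ (hne _), one_pow]
  · funext i
    rw [Matrix.mul_smul, Matrix.mul_one, smul_smul, mul_inv_cancel₀ (hne _), one_smul]
end
end

section
/- With the setup below, consider the ℝ-linear map τ from 𝔲(A) := {t ∈ A : star t = -t} to the ℝ-vector space of ℂ-linear endomorphisms of H, given by τ(t) := (h ↦ t · h + J (t · (J⁻¹ h))). Then: (a) the kernel of τ equals 𝔲(A) ∩ A_J (equivalently, {t ∈ 𝔲(A) : each t i is a purely imaginary scalar multiple λ_i • 1 with λ_i = λ_j whenever i ∼ j}); (b) setting 𝔲₀ := {t ∈ 𝔲(A) : for every equivalence class c of ∼, the trace of the endomorphism h ↦ t · h of H_c is 0}, one has the direct sum decomposition of real vector spaces 𝔲(A) = (𝔲(A) ∩ A_J) ⊕ 𝔲₀, and the restriction of τ to 𝔲₀ is injective. -/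
open Matrix

noncomputable section

namespace Stmt13

variable {I : Type} {N : I → ℕ} {m : I → I → ℕ}

/-- The algebra `A = Π_{i} M_{N i}(ℂ)`. -/
abbrev AS (N : I → ℕ) : Type :=
  ∀ i : I, Matrix (Fin (N i)) (Fin (N i)) ℂ

/-- The Hilbert space `H = ⊕_{i j} ⊕_{α < m i j} M_{N i, N j}(ℂ)`. -/
abbrev HS (N : I → ℕ) (m : I → I → ℕ) : Type :=
  ∀ i j : I, Fin (m i j) → Matrix (Fin (N i)) (Fin (N j)) ℂ

/-- The action of `a ∈ A` on `H` by left block multiplication, as a `ℂ`-linear map. -/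
def actL (N : I → ℕ) (m : I → I → ℕ) (a : AS N) : HS N m →ₗ[ℂ] HS N m where
  toFun h := fun i j α => a i * h i j α
  map_add' h h' := by
    funext i j α
    show a i * (h i j α + h' i j α) = a i * h i j α + a i * h' i j α
    rw [Matrix.mul_add]
  map_smul' c h := by
    funext i j α
    show a i * (c • h i j α) = c • (a i * h i j α)
    rw [Matrix.mul_smul]

/-- The subspace `H_c ⊆ H` of elements supported on the summands `(i,j,α)` with `i ∈ c`. -/
def Hc (N : I → ℕ) (m : I → I → ℕ) (c : Set I) : Submodule ℂ (HS N m) where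
  carrier := {h | ∀ i, i ∉ c → ∀ j α, h i j α = 0}
  add_mem' := by
    intro h h' hh hh' i hi j α
    show h i j α + h' i j α = 0
    rw [hh i hi j α, hh' i hi j α, add_zero]
  zero_mem' := by intro i _ j α; rfl
  smul_mem' := by
    intro t h hh i hi j α
    show t • h i j α = 0
    rw [hh i hi j α, smul_zero]

/-- The action of `a ∈ A` preserves `H_c`. -/
theorem actL_mem_Hc (N : I → ℕ) (m : I → I → ℕ) (c : Set I) (a : AS N) :
    ∀ h ∈ Hc N m c, actL N m a h ∈ Hc N m c := by
  intro h hh i hi j α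
  show a i * h i j α = 0
  rw [hh i hi j α, Matrix.mul_zero]

/-- `det_c a`: the determinant of the endomorphism `h ↦ a · h` of the subspace `H_c`. -/
def detc (N : I → ℕ) (m : I → I → ℕ) (c : Set I) (a : AS N) : ℂ :=
  LinearMap.det ((actL N m a).restrict (actL_mem_Hc N m c a))


/-- The trace of the endomorphism `h ↦ a · h` of the subspace `H_c`. -/
def trc (N : I → ℕ) (m : I → I → ℕ) (c : Set I) (a : AS N) : ℂ :=
  LinearMap.trace ℂ (Hc N m c) ((actL N m a).restrict (actL_mem_Hc N m c a))

/-- The conjugate-linear map `J` on `H`: `(J h)_{(i,j,α)} = s i j α • (h_{(j,i,α)})ᴴ`. -/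
def Jmap (hm : ∀ i j, m i j = m j i) (s : ∀ i j : I, Fin (m i j) → ℂ)
    (h : HS N m) : HS N m :=
  fun i j α => s i j α • (h j i (Fin.cast (hm i j) α))ᴴ

/-- The inverse of `Jmap` (for signs `s` taking values in `{1,-1}`). -/
def Jinv (hm : ∀ i j, m i j = m j i) (s : ∀ i j : I, Fin (m i j) → ℂ)
    (h : HS N m) : HS N m :=
  fun i j α => s j i (Fin.cast (hm i j) α) • (h j i (Fin.cast (hm i j) α))ᴴ

/-- `A_J = {a ∈ A : a · (J h) = J ((star a) · h) for all h}`. -/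
def AJ (N : I → ℕ) (m : I → I → ℕ) (hm : ∀ i j, m i j = m j i)
    (s : ∀ i j : I, Fin (m i j) → ℂ) : Set (AS N) :=
  {a | ∀ h : HS N m,
    (fun i j α => a i * Jmap hm s h i j α) = Jmap hm s (fun i j α => (a i)ᴴ * h i j α)}

/-- `τ(t) : H → H`, `τ(t) h = t · h + J (t · (J⁻¹ h))`. -/
def tau (N : I → ℕ) (m : I → I → ℕ) (hm : ∀ i j, m i j = m j i)
    (s : ∀ i j : I, Fin (m i j) → ℂ) (t : AS N) (h : HS N m) : HS N m :=
  (fun i j α => t i * h i j α) + Jmap hm s (fun i j α => t i * Jinv hm s h i j α)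

/-- `𝔲(A)`, the anti-hermitian elements of `A`. -/
def uA (N : I → ℕ) : Set (AS N) := {t | ∀ i, (t i)ᴴ = -(t i)}

/-- `𝔲₀`, the elements of `𝔲(A)` whose trace on each `H_c` vanishes. -/
def u0 (N : I → ℕ) (m : I → I → ℕ) : Set (AS N) :=
  {t | t ∈ uA N ∧
    ∀ i : I, trc N m {j | Relation.EqvGen (fun a b => m a b ≠ 0) i j} t = 0}

end Stmt13

open Stmt13 in
theorem Stmt13.tau_ap {I : Type} (N : I → ℕ)
    (m : I → I → ℕ) (hm : ∀ i j, m i j = m j i)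
    (s : ∀ i j : I, Fin (m i j) → ℂ) (hs : ∀ i j α, s i j α = 1 ∨ s i j α = -1)
    (t : AS N) (h : HS N m) (i j : I) (α : Fin (m i j)) :
    tau N m hm s t h i j α = t i * h i j α + h i j α * (t j)ᴴ := by
  show t i * h i j α + s i j α • (t j * (s i j α • (h i j α)ᴴ))ᴴ = _
  rcases hs i j α with e | e <;> rw [e] <;> simp [Matrix.conjTranspose_mul]

/-- the commutation condition -/
def Stmt13.Comm {I : Type} (N : I → ℕ) (m : I → I → ℕ) (t : Stmt13.AS N) : Prop :=
  ∀ i j, m i j ≠ 0 → ∀ X : Matrix (Fin (N i)) (Fin (N j)) ℂ, t i * X = X * t j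

open Stmt13 in
theorem Stmt13.ext_elem {I : Type} (N : I → ℕ) (m : I → I → ℕ) (i j : I) (h : m i j ≠ 0)
    (X : Matrix (Fin (N i)) (Fin (N j)) ℂ) : ∃ (h : HS N m) (α : Fin (m i j)), h i j α = X ∧
      ∀ i', i' ≠ i → ∀ j' β, h i' j' β = 0 := by
  classical
  refine ⟨Pi.single i (Pi.single j fun _ => X), ⟨0, Nat.pos_of_ne_zero h⟩, by simp, ?_⟩
  intro i' hi j' β
  rw [Pi.single_eq_of_ne hi]
  rfl

open Stmt13 in
theorem Stmt13.tau_iff {I : Type} (N : I → ℕ)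
    (m : I → I → ℕ) (hm : ∀ i j, m i j = m j i)
    (s : ∀ i j : I, Fin (m i j) → ℂ) (hs : ∀ i j α, s i j α = 1 ∨ s i j α = -1)
    (t : AS N) (ht : t ∈ uA N) : (∀ h, tau N m hm s t h = 0) ↔ Comm N m t := by
  constructor
  · intro H i j hij X
    obtain ⟨h, α, hX, -⟩ := ext_elem N m i j hij X
    have := congrFun (congrFun (congrFun (H h) i) j) α
    rw [tau_ap N m hm s hs, hX, ht j] at this
    have h2 : t i * X + X * (-t j) = 0 := this
    rw [Matrix.mul_neg, ← sub_eq_add_neg] at h2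
    exact sub_eq_zero.mp h2
  · intro H h
    funext i j α
    rw [tau_ap N m hm s hs, ht j, H i j (fun e => (Fin.cast e α).elim0)]
    simp

open Stmt13 in
theorem Stmt13.AJ_iff {I : Type} (N : I → ℕ)
    (m : I → I → ℕ) (hm : ∀ i j, m i j = m j i)
    (s : ∀ i j : I, Fin (m i j) → ℂ) (hs : ∀ i j α, s i j α = 1 ∨ s i j α = -1)
    (t : AS N) : t ∈ AJ N m hm s ↔ Comm N m t := by
  constructor
  · intro H i j hij X
    obtain ⟨h, α, hX, -⟩ := ext_elem N m j i (by rwa [← hm i j]) Xᴴ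
    have := congrFun (congrFun (congrFun (H h) i) j) (Fin.cast (hm j i) α)
    have h2 : t i * (s i j (Fin.cast (hm j i) α) • (h j i α)ᴴ) =
      s i j (Fin.cast (hm j i) α) • ((t j)ᴴ * h j i α)ᴴ := this
    rw [hX] at h2
    rcases hs i j (Fin.cast (hm j i) α) with e | e <;> rw [e] at h2 <;>
      simpa [Matrix.conjTranspose_mul] using h2
  · intro H h
    funext i j α
    show t i * (s i j α • (h j i (Fin.cast (hm i j) α))ᴴ) =
      s i j α • ((t j)ᴴ * h j i (Fin.cast (hm i j) α))ᴴ
    rw [Matrix.mul_smul, H i j (fun e => (Fin.cast e α).elim0)]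
    simp [Matrix.conjTranspose_mul]

open Stmt13 in
theorem Stmt13.comm_iff {I : Type} (N : I → ℕ) (hN : ∀ i, 0 < N i)
    (m : I → I → ℕ) (hm : ∀ i j, m i j = m j i) (hfaith : ∀ i, ∃ j, m i j ≠ 0)
    (t : AS N) (ht : t ∈ uA N) : Comm N m t ↔ ∃ lam : I → ℂ, (∀ i, (lam i).re = 0) ∧
          (∀ i, t i = lam i • (1 : Matrix (Fin (N i)) (Fin (N i)) ℂ)) ∧
          ∀ i j, Relation.EqvGen (fun a b => m a b ≠ 0) i j → lam i = lam j := by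
  classical
  constructor
  · intro H
    have diag : ∀ i j, m i j ≠ 0 → ∀ a b, t i a a = t j b b := by
      intro i j hij a b
      have := congrFun (congrFun (H i j hij (Matrix.single a b 1)) a) b
      simpa using this
    have off : ∀ i, ∀ p a, p ≠ a → t i p a = 0 := by
      intro i p a hpa
      obtain ⟨j, hij⟩ := hfaith i
      have := congrFun (congrFun (H i j hij (Matrix.single a ⟨0, hN j⟩ 1)) p) ⟨0, hN j⟩
      simpa [hpa, Matrix.single_mul_apply_of_ne] using this
    refine ⟨fun i => t i ⟨0, hN i⟩ ⟨0, hN i⟩, ?_, ?_, ?_⟩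
    · intro i
      have := congrArg Complex.re (congrFun (congrFun (ht i) ⟨0, hN i⟩) ⟨0, hN i⟩)
      simp at this
      simp only []
      linarith
    · intro i
      ext p a
      by_cases hpa : p = a
      · subst hpa
        obtain ⟨j, hij⟩ := hfaith i
        simp [diag i j hij p ⟨0, hN j⟩, diag i j hij ⟨0, hN i⟩ ⟨0, hN j⟩]
      · simp [off i p a hpa, hpa]
    · intro i j hij
      induction hij with
      | rel x y h => exact diag x y h _ _
      | refl x => rfl
      | symm x y _ ih => exact ih.symm
      | trans x y z _ _ h1 h2 => exact h1.trans h2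
  · rintro ⟨lam, -, h1, h2⟩ i j hij X
    rw [h1 i, h1 j, h2 i j (Relation.EqvGen.rel _ _ hij)]
    simp

open Stmt13 in
theorem Stmt13.trc_scalar {I : Type} [Fintype I] (N : I → ℕ) (m : I → I → ℕ) (c : Set I)
    (a : AS N) (z : ℂ) (h : ∀ i ∈ c, a i = z • 1) :
    trc N m c a = z * (Module.finrank ℂ (Hc N m c) : ℂ) := by
  have : (actL N m a).restrict (actL_mem_Hc N m c a) = z • LinearMap.id := by
    ext1 ⟨x, hx⟩
    apply Subtype.ext
    funext i j α
    show a i * x i j α = z • x i j α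
    by_cases hi : i ∈ c
    · rw [h i hi]; simp
    · rw [hx i hi j α]; simp
  rw [trc, this, map_smul, LinearMap.trace_id, smul_eq_mul]

open Stmt13 in
theorem Stmt13.trc_add {I : Type} [Fintype I] (N : I → ℕ) (m : I → I → ℕ) (c : Set I)
    (a b : AS N) : trc N m c (a + b) = trc N m c a + trc N m c b := by
  rw [trc, trc, trc, ← map_add]
  congr 1
  ext1 ⟨x, hx⟩
  apply Subtype.ext
  funext i j α
  exact Matrix.add_mul (a i) (b i) (x i j α)

open Stmt13 in
theorem Stmt13.trc_re {I : Type} [Fintype I] (N : I → ℕ) (m : I → I → ℕ) (c : Set I)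
    (a : AS N) (ha : a ∈ uA N) : (trc N m c a).re = 0 := by
  classical
  let a' : AS N := fun i => if i ∈ c then a i else 0
  have h0 : trc N m c a = trc N m c a' := by
    rw [trc, trc]
    congr 1
    ext1 ⟨x, hx⟩
    apply Subtype.ext
    funext i j α
    show a i * x i j α = a' i * x i j α
    by_cases hi : i ∈ c
    · simp [a', hi]
    · rw [hx i hi j α]; simp
  have h1 : trc N m c a' = LinearMap.trace ℂ (HS N m) (actL N m a') := by
    rw [trc]
    apply LinearMap.trace_restrict_eq_of_forall_mem
    intro x i hi j α
    show a' i * x i j α = 0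
    simp [a', hi]
  have hd : ∀ i p, (a' i p p).re = 0 := by
    intro i p
    by_cases hi : i ∈ c
    · have := congrArg Complex.re (congrFun (congrFun (ha i) p) p)
      simp at this
      simp only [a', hi, if_true]
      linarith
    · simp [a', hi]
  let b := Pi.basis fun i : I => Pi.basis fun j : I => Pi.basis fun _ : Fin (m i j) =>
    Matrix.stdBasis ℂ (Fin (N i)) (Fin (N j))
  rw [h0, h1, LinearMap.trace_eq_matrix_trace ℂ b, Matrix.trace, Complex.re_sum]
  apply Finset.sum_eq_zero
  rintro ⟨i, j, α, p, q⟩ -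
  rw [Matrix.diag_apply, LinearMap.toMatrix_apply]
  have e : b ⟨i, j, α, p, q⟩ i j α = Matrix.single p q 1 := by
    simp [b, Pi.basis_apply, Matrix.stdBasis_eq_single]
  have : b.repr (actL N m a' (b ⟨i, j, α, p, q⟩)) ⟨i, j, α, p, q⟩
      = (a' i * b ⟨i, j, α, p, q⟩ i j α) p q := by
    simp only [b, Pi.basis_repr]
    rfl
  rw [this, e]
  simpa using hd i p

open Stmt13 in
theorem Stmt13.finrank_pos {I : Type} [Fintype I] (N : I → ℕ) (hN : ∀ i, 0 < N i)
    (m : I → I → ℕ) (hfaith : ∀ i, ∃ j, m i j ≠ 0) (c : Set I) (i : I) (hi : i ∈ c) :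
    (Module.finrank ℂ (Hc N m c) : ℂ) ≠ 0 := by
  obtain ⟨j, hij⟩ := hfaith i
  obtain ⟨h, α, e, hh⟩ := ext_elem N m i j hij (Matrix.of fun _ _ => 1)
  have hmem : h ∈ Hc N m c := by
    intro i' hi' j' β
    exact hh i' (fun e => hi' (e ▸ hi)) j' β
  have : Nontrivial (Hc N m c) := by
    refine ⟨⟨h, hmem⟩, 0, fun e0 => ?_⟩
    have e1 : h = 0 := congrArg Subtype.val e0
    rw [e1] at e
    have := congrFun (congrFun e ⟨0, hN i⟩) ⟨0, hN j⟩
    simp at this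
  exact_mod_cast (Module.finrank_pos (R := ℂ) (M := Hc N m c)).ne'

open Stmt13 in
theorem Stmt13.inter_zero {I : Type} [Fintype I] (N : I → ℕ) (hN : ∀ i, 0 < N i)
    (m : I → I → ℕ) (hm : ∀ i j, m i j = m j i) (hfaith : ∀ i, ∃ j, m i j ≠ 0)
    (t : AS N) (ht : t ∈ uA N) (hc : Comm N m t) (h0 : t ∈ u0 N m) : t = 0 := by
  obtain ⟨lam, -, h1, h2⟩ := (comm_iff N hN m hm hfaith t ht).1 hc
  funext i
  have := h0.2 i
  rw [trc_scalar N m _ t (lam i) (fun j hj => by rw [h1 j, h2 i j hj])] at this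
  have hz := (mul_eq_zero.1 this).resolve_right
    (finrank_pos N hN m hfaith _ i (Relation.EqvGen.refl i))
  rw [h1 i, hz]
  simp

/-- **Lemma 7.1 of the paper (fibrewise content).**
(a) For `t ∈ 𝔲(A)`, `τ(t) = 0` iff `t ∈ A_J`, iff each `t i` is a purely imaginary scalar
`λ i • 1` with `λ i = λ j` whenever `i ∼ j`.
(b) `𝔲(A) = (𝔲(A) ∩ A_J) ⊕ 𝔲₀` as real vector spaces, and `τ` is injective on `𝔲₀`. -/
theorem stmt_13 {I : Type} [Fintype I] [Nonempty I] (N : I → ℕ) (hN : ∀ i, 0 < N i)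
    (m : I → I → ℕ) (hm : ∀ i j, m i j = m j i) (hfaith : ∀ i, ∃ j, m i j ≠ 0)
    (s : ∀ i j : I, Fin (m i j) → ℂ) (hs : ∀ i j α, s i j α = 1 ∨ s i j α = -1) :
    (∀ t ∈ Stmt13.uA N,
      ((∀ h, Stmt13.tau N m hm s t h = 0) ↔ t ∈ Stmt13.AJ N m hm s) ∧
      ((∀ h, Stmt13.tau N m hm s t h = 0) ↔
        ∃ lam : I → ℂ, (∀ i, (lam i).re = 0) ∧
          (∀ i, t i = lam i • (1 : Matrix (Fin (N i)) (Fin (N i)) ℂ)) ∧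
          ∀ i j, Relation.EqvGen (fun a b => m a b ≠ 0) i j → lam i = lam j)) ∧
    (∀ t ∈ Stmt13.uA N, ∃ q r : Stmt13.AS N,
      q ∈ Stmt13.uA N ∧ q ∈ Stmt13.AJ N m hm s ∧ r ∈ Stmt13.u0 N m ∧ t = q + r) ∧
    (∀ t : Stmt13.AS N, t ∈ Stmt13.uA N → t ∈ Stmt13.AJ N m hm s → t ∈ Stmt13.u0 N m →
      t = 0) ∧
    (∀ t ∈ Stmt13.u0 N m, ∀ t' ∈ Stmt13.u0 N m,
      (∀ h, Stmt13.tau N m hm s t h = Stmt13.tau N m hm s t' h) → t = t') := by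
  have hT := fun t ht => Stmt13.tau_iff N m hm s hs t ht
  have hA := fun t => Stmt13.AJ_iff N m hm s hs t
  have hC := fun t ht => Stmt13.comm_iff N hN m hm hfaith t ht
  have sub_u : ∀ t ∈ Stmt13.uA N, ∀ t' ∈ Stmt13.uA N, t - t' ∈ Stmt13.uA N := by
    intro t ht t' ht' i
    show (t i - t' i)ᴴ = -(t i - t' i)
    rw [Matrix.conjTranspose_sub, ht i, ht' i]
    abel
  refine ⟨fun t ht => ⟨(hT t ht).trans (hA t).symm, (hT t ht).trans (hC t ht)⟩, ?_, ?_, ?_⟩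
  · intro t ht
    let c : I → Set I := fun i => {j | Relation.EqvGen (fun a b => m a b ≠ 0) i j}
    let lam : I → ℂ := fun i => Stmt13.trc N m (c i) t / (Module.finrank ℂ (Stmt13.Hc N m (c i)) : ℂ)
    have hcc : ∀ i j, Relation.EqvGen (fun a b => m a b ≠ 0) i j → c i = c j := by
      intro i j hij
      ext k
      exact ⟨fun h => (hij.symm).trans _ _ _ h, fun h => hij.trans _ _ _ h⟩
    have hl : ∀ i j, Relation.EqvGen (fun a b => m a b ≠ 0) i j → lam i = lam j := by
      intro i j hij
      exact congrArg (fun d => Stmt13.trc N m d t / (Module.finrank ℂ (Stmt13.Hc N m d) : ℂ)) (hcc i j hij)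
    have hre : ∀ i, (lam i).re = 0 := by
      intro i
      simp only [lam]
      rw [Complex.div_natCast_re, Stmt13.trc_re N m _ t ht, zero_div]
    let q : Stmt13.AS N := fun i => lam i • 1
    have hq : q ∈ Stmt13.uA N := by
      intro i
      show (lam i • (1 : Matrix (Fin (N i)) (Fin (N i)) ℂ))ᴴ = -(lam i • 1)
      rw [Matrix.conjTranspose_smul, Matrix.conjTranspose_one, ← neg_smul]
      congr 1
      apply Complex.ext <;> simp [hre i]
    refine ⟨q, t - q, hq, (hA q).2 ((hC q hq).2 ⟨lam, hre, fun i => rfl, hl⟩),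
      ⟨sub_u t ht q hq, ?_⟩, by abel⟩
    intro i
    have h1 := Stmt13.trc_add N m (c i) q (t - q)
    rw [add_sub_cancel, Stmt13.trc_scalar N m (c i) q (lam i)
      (fun j hj => by show lam j • 1 = _; rw [hl i j hj])] at h1
    have h2 : lam i * (Module.finrank ℂ (Stmt13.Hc N m (c i)) : ℂ) = Stmt13.trc N m (c i) t :=
      div_mul_cancel₀ _ (Stmt13.finrank_pos N hN m hfaith (c i) i (Relation.EqvGen.refl i))
    rw [h2] at h1
    exact left_eq_add.mp h1
  · intro t ht hJ h0
    exact Stmt13.inter_zero N hN m hm hfaith t ht ((hA t).1 hJ) h0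
  · intro t ht t' ht' H
    have hu := sub_u t ht.1 t' ht'.1
    refine sub_eq_zero.1 (Stmt13.inter_zero N hN m hm hfaith (t - t') hu ((hT _ hu).1 ?_) ⟨hu, ?_⟩)
    · intro h
      funext i j α
      have := congrFun (congrFun (congrFun (H h) i) j) α
      rw [Stmt13.tau_ap N m hm s hs, Stmt13.tau_ap N m hm s hs] at this
      rw [Stmt13.tau_ap N m hm s hs]
      show (t i - t' i) * h i j α + h i j α * (t j - t' j)ᴴ = 0
      rw [Matrix.sub_mul, Matrix.conjTranspose_sub, Matrix.mul_sub]
      rw [← sub_eq_zero] at this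
      rw [← this]
      abel
    · intro i
      have h1 := Stmt13.trc_add N m {j | Relation.EqvGen (fun a b => m a b ≠ 0) i j} t' (t - t')
      rw [add_sub_cancel, ht.2 i, ht'.2 i, zero_add] at h1
      exact h1.symm
end
end
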